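/- et μ be a finite nonzero Borel measure on ℝ^N, let f : ℝ^N → ℝ be bounded and continuous, and let x ∈ ℝ^N be a point of positive lower n-density for μ: there exist c > 0 and r₀ > 0 such that μ(B(x,r)) ≥ c·rⁿ for all 0 < r < r₀. Then the ε-mollifications converge pointwise at x: f_ε(x) → f(x) as ε → 0⁺. (For an integer-rectifiable n-varifold every point with an approximate tangent plane has positive lower n-density, so f_ε → f holds ‖V‖-almost everywhere.) -/

import Mathlib

open MeasureTheory Filter Topology

/-- The smooth bump profile `g(t) = exp(1/(t² − 1))` for `t < 1`, `0` for `t ≥ 1`. -/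
noncomputable def gProfile (t : ℝ) : ℝ :=
  if t < 1 then Real.exp (1 / (t ^ 2 - 1)) else 0

/-- The mollifier `φ_ε(x) = C · ε^{−n} · g(‖x‖/ε)` on `ℝ^N`, supported in the
ball of radius `ε`; `C` is a fixed normalizing constant. -/
noncomputable def molKernel (N n : ℕ) (C ε : ℝ) (x : EuclideanSpace ℝ (Fin N)) : ℝ :=
  C * ε ^ (-(n : ℤ)) * gProfile (‖x‖ / ε)

/-- The `ε`-mollification of `f` with respect to the measure `μ`:
`f_ε(x) = (∫ f(y) φ_ε(x − y) dμ(y)) / (∫ φ_ε(x − z) dμ(z) + ε·μ(ℝ^N))`. -/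
noncomputable def mollify (N n : ℕ) (C : ℝ) (μ : Measure (EuclideanSpace ℝ (Fin N)))
    (ε : ℝ) (f : EuclideanSpace ℝ (Fin N) → ℝ) (x : EuclideanSpace ℝ (Fin N)) : ℝ :=
  (∫ y, f y * molKernel N n C ε (x - y) ∂μ) /
    ((∫ z, molKernel N n C ε (x - z) ∂μ) + ε * (μ Set.univ).toReal)

theorem gProfile_nonneg (t : ℝ) : 0 ≤ gProfile t := by
  unfold gProfile
  split_ifs
  · exact (Real.exp_pos _).le
  · exact le_rfl

theorem gProfile_le_one {t : ℝ} (ht : 0 ≤ t) : gProfile t ≤ 1 := by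
  unfold gProfile
  split_ifs with h
  · rw [Real.exp_le_one_iff]
    exact div_nonpos_of_nonneg_of_nonpos zero_le_one (by nlinarith)
  · exact zero_le_one

theorem exp_le_gProfile {t : ℝ} (ht : 0 ≤ t) (ht' : t ≤ 1 / 2) :
    Real.exp (-2) ≤ gProfile t := by
  unfold gProfile
  rw [if_pos (by linarith), Real.exp_le_exp, le_div_iff_of_neg (by nlinarith)]
  nlinarith

theorem measurable_gProfile : Measurable gProfile :=
  Measurable.ite measurableSet_Iio (by fun_prop) measurable_const

section molKernel

variable {N n : ℕ} {C ε : ℝ}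

theorem molKernel_nonneg (hC : 0 ≤ C) (hε : 0 ≤ ε) (x : EuclideanSpace ℝ (Fin N)) :
    0 ≤ molKernel N n C ε x :=
  mul_nonneg (mul_nonneg hC (zpow_nonneg hε _)) (gProfile_nonneg _)

theorem molKernel_le (hC : 0 ≤ C) (hε : 0 ≤ ε) (x : EuclideanSpace ℝ (Fin N)) :
    molKernel N n C ε x ≤ C * ε ^ (-(n : ℤ)) :=
  mul_le_of_le_one_right (mul_nonneg hC (zpow_nonneg hε _))
    (gProfile_le_one (div_nonneg (norm_nonneg _) hε))

theorem molKernel_eq_zero (hε : 0 < ε) {x : EuclideanSpace ℝ (Fin N)} (hx : ε ≤ ‖x‖) :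
    molKernel N n C ε x = 0 := by
  have h : ¬ ‖x‖ / ε < 1 := not_lt.2 ((one_le_div hε).2 hx)
  simp [molKernel, gProfile, h]

theorem measurable_molKernel : Measurable (molKernel N n C ε) :=
  (measurable_gProfile.comp (measurable_norm.div_const ε)).const_mul _

variable (μ : Measure (EuclideanSpace ℝ (Fin N))) [IsFiniteMeasure μ]

theorem integrable_molKernel_sub (hC : 0 ≤ C) (hε : 0 ≤ ε) (x : EuclideanSpace ℝ (Fin N)) :
    Integrable (fun y => molKernel N n C ε (x - y)) μ := by
  refine Integrable.of_bound
    (measurable_molKernel.comp (measurable_const.sub measurable_id)).aestronglyMeasurable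
    (C * ε ^ (-(n : ℤ))) (Eventually.of_forall fun y => ?_)
  rw [Real.norm_of_nonneg (molKernel_nonneg hC hε _)]
  exact molKernel_le hC hε _

theorem mul_measureReal_ball_le_integral_molKernel (hC : 0 ≤ C) (hε : 0 < ε)
    (x : EuclideanSpace ℝ (Fin N)) :
    C * ε ^ (-(n : ℤ)) * Real.exp (-2) * μ.real (Metric.ball x (ε / 2)) ≤
      ∫ y, molKernel N n C ε (x - y) ∂μ := by
  have hint := integrable_molKernel_sub (n := n) μ hC hε.le x
  calc C * ε ^ (-(n : ℤ)) * Real.exp (-2) * μ.real (Metric.ball x (ε / 2))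
      ≤ ∫ y in Metric.ball x (ε / 2), molKernel N n C ε (x - y) ∂μ := by
        refine setIntegral_ge_of_const_le_real measurableSet_ball (measure_ne_top _ _)
          (fun y hy => ?_) hint.integrableOn
        rw [Metric.mem_ball, dist_comm, dist_eq_norm] at hy
        refine mul_le_mul_of_nonneg_left (exp_le_gProfile (by positivity) ?_) (by positivity)
        rw [div_le_iff₀ hε]
        linarith
    _ ≤ ∫ y, molKernel N n C ε (x - y) ∂μ :=
        setIntegral_le_integral hint
          (Eventually.of_forall fun y => molKernel_nonneg hC hε.le _)

/-- A density bound on the ball of radius `ε / 2` bounds the kernel mass from below,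
independently of `ε`. -/
theorem le_integral_molKernel_of_density (hC : 0 ≤ C) (hε : 0 < ε)
    (x : EuclideanSpace ℝ (Fin N)) {c : ℝ}
    (h : ENNReal.ofReal (c * (ε / 2) ^ n) ≤ μ (Metric.ball x (ε / 2))) :
    C * Real.exp (-2) * (c / 2 ^ n) ≤ ∫ y, molKernel N n C ε (x - y) ∂μ := by
  refine le_trans ?_ (mul_measureReal_ball_le_integral_molKernel μ hC hε x)
  have h' : c * (ε / 2) ^ n ≤ μ.real (Metric.ball x (ε / 2)) :=
    (ENNReal.ofReal_le_iff_le_toReal (measure_ne_top _ _)).1 h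
  refine le_trans (le_of_eq ?_) (mul_le_mul_of_nonneg_left h' (by positivity))
  rw [zpow_neg, zpow_natCast, div_pow]
  field_simp

theorem abs_integral_mul_molKernel_sub_le (hC : 0 ≤ C) (hε : 0 < ε)
    {f : EuclideanSpace ℝ (Fin N) → ℝ} (hf : AEStronglyMeasurable f μ)
    {M : ℝ} (hfb : ∀ y, |f y| ≤ M) (x : EuclideanSpace ℝ (Fin N)) {δ : ℝ}
    (hδ : ∀ y, dist y x < ε → |f y - f x| ≤ δ) :
    |(∫ y, f y * molKernel N n C ε (x - y) ∂μ) - f x * ∫ y, molKernel N n C ε (x - y) ∂μ| ≤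
      δ * ∫ y, molKernel N n C ε (x - y) ∂μ := by
  have hint := integrable_molKernel_sub (n := n) μ hC hε.le x
  have hfint : Integrable (fun y => f y * molKernel N n C ε (x - y)) μ :=
    hint.bdd_mul hf (Eventually.of_forall hfb)
  rw [← integral_const_mul, ← integral_const_mul, ← integral_sub hfint (hint.const_mul _),
    ← Real.norm_eq_abs]
  refine norm_integral_le_of_norm_le (hint.const_mul δ) (Eventually.of_forall fun y => ?_)
  rw [← sub_mul, norm_mul, Real.norm_of_nonneg (molKernel_nonneg hC hε.le _), Real.norm_eq_abs]
  rcases lt_or_ge (dist y x) ε with h | h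
  · exact mul_le_mul_of_nonneg_right (hδ y h) (molKernel_nonneg hC hε.le _)
  · rw [dist_comm, dist_eq_norm] at h
    simp [molKernel_eq_zero hε h]

/-- A quantitative form of convergence: the error is controlled by the oscillation `δ` of `f`
on the `ε`-ball and a term of order `ε` coming from the regularized denominator. -/
theorem abs_mollify_sub_le (hC : 0 ≤ C) (hε : 0 < ε)
    {f : EuclideanSpace ℝ (Fin N) → ℝ} (hf : AEStronglyMeasurable f μ)
    {M : ℝ} (hfb : ∀ y, |f y| ≤ M) (x : EuclideanSpace ℝ (Fin N)) {δ a : ℝ}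
    (hδ : ∀ y, dist y x < ε → |f y - f x| ≤ δ) (ha : 0 < a)
    (haD : a ≤ ∫ y, molKernel N n C ε (x - y) ∂μ) :
    |mollify N n C μ ε f x - f x| ≤ δ + |f x| * (ε * (μ Set.univ).toReal) / a := by
  have key := abs_integral_mul_molKernel_sub_le (n := n) μ hC hε hf hfb x hδ
  have hδ₀ : 0 ≤ δ := (abs_nonneg _).trans (hδ x (by simpa using hε))
  unfold mollify
  set A := ∫ y, f y * molKernel N n C ε (x - y) ∂μ
  set D := ∫ y, molKernel N n C ε (x - y) ∂μ
  set m := ε * (μ Set.univ).toReal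
  have hm : 0 ≤ m := by positivity
  have hD : 0 < D + m := by linarith
  rw [div_sub' hD.ne', abs_div, abs_of_pos hD, div_le_iff₀ hD]
  have hnum : |A - (D + m) * f x| ≤ δ * D + |f x| * m := by
    calc |A - (D + m) * f x| = |(A - f x * D) - f x * m| := by ring_nf
      _ ≤ |A - f x * D| + |f x * m| := abs_sub _ _
      _ ≤ δ * D + |f x| * m := by rw [abs_mul, abs_of_nonneg hm]; gcongr
  have h1 : |f x| * m ≤ |f x| * m / a * (D + m) := by
    calc |f x| * m = |f x| * m / a * a := by field_simp
      _ ≤ |f x| * m / a * (D + m) := by gcongr; linarith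
  nlinarith [mul_nonneg hδ₀ hm]

end molKernel

/-- Pointwise convergence of mollifications at a point of positive lower
`n`-density: if `f` is bounded and continuous and `μ(B(x,r)) ≥ c rⁿ` for all
`0 < r < r₀`, then `f_ε(x) → f(x)` as `ε → 0⁺`. -/
theorem mollify_tendsto_of_density (N n : ℕ) (hN : 1 ≤ N) (hn : 1 ≤ n)
    (C : ℝ) (hC : 0 < C)
    (μ : Measure (EuclideanSpace ℝ (Fin N))) [IsFiniteMeasure μ] (hμ : μ ≠ 0)
    (f : EuclideanSpace ℝ (Fin N) → ℝ) (hfc : Continuous f)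
    (M : ℝ) (hfb : ∀ y, |f y| ≤ M)
    (x : EuclideanSpace ℝ (Fin N)) (c r₀ : ℝ) (hc : 0 < c) (hr₀ : 0 < r₀)
    (hdens : ∀ r : ℝ, 0 < r → r < r₀ →
      ENNReal.ofReal (c * r ^ n) ≤ μ (Metric.ball x r)) :
    Tendsto (fun ε => mollify N n C μ ε f x) (𝓝[>] (0:ℝ)) (𝓝 (f x)) := by
  have ha : 0 < C * Real.exp (-2) * (c / 2 ^ n) := by positivity
  set a := C * Real.exp (-2) * (c / 2 ^ n)
  rw [Metric.tendsto_nhds]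
  intro η hη
  obtain ⟨ρ, hρ, hfρ⟩ := Metric.continuousAt_iff.1 hfc.continuousAt (η / 2) (half_pos hη)
  have hsmall : ∀ᶠ ε in 𝓝[>] (0 : ℝ), |f x| * (ε * (μ Set.univ).toReal) / a < η / 2 := by
    have hcont : Continuous fun ε : ℝ => |f x| * (ε * (μ Set.univ).toReal) / a := by fun_prop
    exact (hcont.tendsto 0 |>.mono_left nhdsWithin_le_nhds).eventually_lt_const
      (by simpa using hη)
  filter_upwards [hsmall, self_mem_nhdsWithin, Ioo_mem_nhdsGT hρ, Ioo_mem_nhdsGT hr₀]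
    with ε hε hε₀ hερ hεr
  have hε₀ : 0 < ε := hε₀
  have hD := le_integral_molKernel_of_density μ hC.le hε₀ x
    (hdens (ε / 2) (half_pos hε₀) (by linarith [hεr.2]))
  have hδ : ∀ y, dist y x < ε → |f y - f x| ≤ η / 2 := fun y hy =>
    (hfρ (hy.trans hερ.2)).le
  have := abs_mollify_sub_le μ hC.le hε₀ hfc.aestronglyMeasurable hfb x hδ ha hD
  rw [Real.dist_eq]
  linarith
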